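/- arXiv:2506.08563 — 2 statements merged into one kernel-verified Lean document; each statement's English description precedes it below -/
import Mathlib

section
/- Let ℓ > 0, let x₁ < x₂ < ⋯ < xₙ be real numbers, and let A₁, …, Aₙ ∈ ℝ satisfy the two conditions Σ_{j=1}^n A_j e^{ℓ x_j} = 0 and Σ_{j=1}^n A_j e^{−ℓ x_j} = 0. Define φ : ℝ → ℝ by φ(x) = Σ_{j=1}^n A_j exp(−ℓ|x − x_j|). Then φ(x) = 0 for every x ≤ x₁ and for every x ≥ xₙ; that is, the support of φ is contained in the interval [x₁, xₙ]. -/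
theorem sum_mul_exp_neg_mul_abs_sub_of_le {ι : Type*} [Fintype ι] (ℓ t : ℝ) (x A : ι → ℝ)
    (ht : ∀ j, t ≤ x j) :
    ∑ j, A j * Real.exp (-ℓ * |t - x j|) =
      Real.exp (ℓ * t) * ∑ j, A j * Real.exp (-ℓ * x j) := by
  rw [Finset.mul_sum]
  refine Finset.sum_congr rfl fun j _ => ?_
  rw [abs_of_nonpos (sub_nonpos.2 (ht j)), mul_left_comm, ← Real.exp_add]
  ring_nf

theorem sum_mul_exp_neg_mul_abs_sub_of_ge {ι : Type*} [Fintype ι] (ℓ t : ℝ) (x A : ι → ℝ)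
    (ht : ∀ j, x j ≤ t) :
    ∑ j, A j * Real.exp (-ℓ * |t - x j|) =
      Real.exp (-ℓ * t) * ∑ j, A j * Real.exp (ℓ * x j) := by
  rw [Finset.mul_sum]
  refine Finset.sum_congr rfl fun j _ => ?_
  rw [abs_of_nonneg (sub_nonneg.2 (ht j)), mul_left_comm, ← Real.exp_add]
  ring_nf

theorem kernel_packet_compact_support (ℓ : ℝ) (hℓ : 0 < ℓ) (n : ℕ)
    (x : Fin (n + 1) → ℝ) (hx : StrictMono x)
    (A : Fin (n + 1) → ℝ)
    (h1 : ∑ j, A j * Real.exp (ℓ * x j) = 0)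
    (h2 : ∑ j, A j * Real.exp (-ℓ * x j) = 0)
    (φ : ℝ → ℝ)
    (hφ : φ = fun t : ℝ => ∑ j, A j * Real.exp (-ℓ * |t - x j|)) :
    (∀ t : ℝ, t ≤ x 0 → φ t = 0) ∧ (∀ t : ℝ, x (Fin.last n) ≤ t → φ t = 0) := by
  subst hφ
  refine ⟨fun t ht => ?_, fun t ht => ?_⟩
  · exact (sum_mul_exp_neg_mul_abs_sub_of_le ℓ t x A
      fun j => ht.trans (hx.monotone (Fin.zero_le j))).trans (by rw [h2, mul_zero])
  · exact (sum_mul_exp_neg_mul_abs_sub_of_ge ℓ t x A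
      fun j => (hx.monotone (Fin.le_last j)).trans ht).trans (by rw [h1, mul_zero])
end

section
/- Let d be a positive integer, T ∈ ℝ, and let v : ℝ^d → ℝ be a bounded C² function whose first and second partial derivatives are bounded and continuous. For t < T define w(x,t) = ∫_{ℝ^d} (2π)^{−d/2} e^{−‖y‖²/2} · v(x − √(2(T−t))·y) dy. Then w is differentiable in t and twice differentiable in x on ℝ^d × (−∞, T), and satisfies the backward heat equation ∂_t w(x,t) + Δ_x w(x,t) = 0 for all x ∈ ℝ^d and t < T, where Δ_x w = Σ_{i=1}^d ∂²w/∂x_i². -/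
open MeasureTheory Real

theorem hasDerivAt_integral_mul_comp_add_smul {E : Type*} [NormedAddCommGroup E] [NormedSpace ℝ E]
    [FiniteDimensional ℝ E] [MeasurableSpace E] [BorelSpace E] {μ : Measure E}
    {K h : E → ℝ} {p q : E → E} {C D : ℝ} (hK : Continuous K) (hp : Continuous p)
    (hq : Continuous q) (hh : ContDiff ℝ 1 h) (hC : ∀ z, |h z| ≤ C) (hD : ∀ z, ‖fderiv ℝ h z‖ ≤ D)
    (hKi : Integrable K μ) (hKq : Integrable (fun y => K y * ‖q y‖) μ) (s : ℝ) :
    HasDerivAt (fun r : ℝ => ∫ y, K y * h (p y + r • q y) ∂μ)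
      (∫ y, K y * fderiv ℝ h (p y + s • q y) (q y) ∂μ) s := by
  have hhc := hh.continuous
  have hhd : Continuous (fderiv ℝ h) := hh.continuous_fderiv one_ne_zero
  refine (hasDerivAt_integral_of_dominated_loc_of_deriv_le (s := Set.univ)
    (F := fun (r : ℝ) y => K y * h (p y + r • q y))
    (F' := fun (r : ℝ) y => K y * fderiv ℝ h (p y + r • q y) (q y))
    (bound := fun y => D * ‖K y * ‖q y‖‖) Filter.univ_mem ?_ ?_ ?_ ?_ ?_ ?_).2
  · exact Filter.Eventually.of_forall fun r => by
      have : Continuous fun y => K y * h (p y + r • q y) := by fun_prop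
      exact this.aestronglyMeasurable
  · refine hKi.mul_bdd (c := C) ?_ (Filter.Eventually.of_forall fun y => hC _)
    have : Continuous fun y => h (p y + s • q y) := by fun_prop
    exact this.aestronglyMeasurable
  · have : Continuous fun y => K y * fderiv ℝ h (p y + s • q y) (q y) := by fun_prop
    exact this.aestronglyMeasurable
  · refine Filter.Eventually.of_forall fun y r _ => ?_
    rw [norm_mul, norm_mul, norm_norm, mul_left_comm]
    gcongr
    exact ContinuousLinearMap.le_of_opNorm_le _ (hD _) _
  · exact hKq.norm.const_mul D
  · refine Filter.Eventually.of_forall fun y r _ => ?_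
    refine HasDerivAt.const_mul (K y) ?_
    have h1 : HasDerivAt (fun r : ℝ => p y + r • q y) (q y) r := by
      simpa using ((hasDerivAt_id r).smul_const (q y)).const_add (p y)
    exact ((hh.differentiable one_ne_zero _).hasFDerivAt).comp_hasDerivAt r h1

theorem integrable_exp_neg_mul_sum_sq {ι : Type*} [Fintype ι] {b : ℝ} (hb : 0 < b) :
    Integrable fun y : ι → ℝ => Real.exp (-b * ∑ i, y i ^ 2) := by
  have := Integrable.fintype_prod (ι := ι) (f := fun _ (z : ℝ) => Real.exp (-b * z ^ 2))
    (μ := fun _ => volume) fun _ => integrable_exp_neg_mul_sq hb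
  simp only [← Real.exp_sum, ← Finset.mul_sum] at this
  exact this

/-- The density of the standard Gaussian measure on `ℝ^d`. -/
noncomputable def stdGaussianDensity (d : ℕ) (y : Fin d → ℝ) : ℝ :=
  (2 * π) ^ (-(d : ℝ) / 2) * Real.exp (-(∑ i, y i ^ 2) / 2)

namespace stdGaussianDensity

variable {d : ℕ}

theorem continuous : Continuous (stdGaussianDensity d) := by
  unfold stdGaussianDensity; fun_prop

theorem integrable : Integrable (stdGaussianDensity d) := by
  have := (integrable_exp_neg_mul_sum_sq (ι := Fin d) (b := 1 / 2) (by norm_num)).const_mul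
    ((2 * π) ^ (-(d : ℝ) / 2))
  refine this.congr (Filter.Eventually.of_forall fun y => ?_)
  simp only [stdGaussianDensity]
  ring_nf

theorem integrable_mul_norm : Integrable fun y : Fin d → ℝ => stdGaussianDensity d y * ‖y‖ := by
  have := (integrable_exp_neg_mul_sum_sq (ι := Fin d) (b := 1 / 4) (by norm_num)).const_mul
    ((2 * π) ^ (-(d : ℝ) / 2))
  refine this.mono' (continuous.mul continuous_norm).aestronglyMeasurable
    (Filter.Eventually.of_forall fun y => ?_)
  have hy : ‖y‖ ≤ Real.exp ((∑ i, y i ^ 2) / 4) := by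
    refine (pi_norm_le_iff_of_nonneg (Real.exp_pos _).le).2 fun i => ?_
    have h1 : y i ^ 2 ≤ ∑ i, y i ^ 2 :=
      Finset.single_le_sum (f := fun i => y i ^ 2) (fun _ _ => sq_nonneg _) (Finset.mem_univ i)
    rw [Real.norm_eq_abs]
    nlinarith [Real.add_one_le_exp ((∑ i, y i ^ 2) / 4), sq_nonneg (1 - |y i| / 2), sq_abs (y i)]
  have h2 : Real.exp (-(1 / 4) * ∑ i, y i ^ 2)
      = Real.exp (-(∑ i, y i ^ 2) / 2) * Real.exp ((∑ i, y i ^ 2) / 4) := by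
    rw [← Real.exp_add]; ring_nf
  rw [h2, Real.norm_of_nonneg (by unfold stdGaussianDensity; positivity), stdGaussianDensity,
    mul_assoc]
  gcongr

theorem hasFDerivAt (y : Fin d → ℝ) : HasFDerivAt (stdGaussianDensity d)
    (-stdGaussianDensity d y • ∑ i, y i • (ContinuousLinearMap.proj i : (Fin d → ℝ) →L[ℝ] ℝ)) y := by
  have h1 : HasFDerivAt (fun y : Fin d → ℝ => ∑ i, y i ^ 2)
      (∑ i, (2 * y i) • (ContinuousLinearMap.proj i : (Fin d → ℝ) →L[ℝ] ℝ)) y := by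
    refine HasFDerivAt.fun_sum fun i _ => ?_
    simpa using (hasFDerivAt_apply (𝕜 := ℝ) i y).pow 2
  have h2 := (((h1.neg.mul_const (1 / 2)).exp).const_mul ((2 * π) ^ (-(d : ℝ) / 2)))
  have h3 : stdGaussianDensity d = fun y : Fin d → ℝ =>
      (2 * π) ^ (-(d : ℝ) / 2) * Real.exp (-(∑ i, y i ^ 2) * (1 / 2)) := by
    funext y; simp [stdGaussianDensity, div_eq_mul_inv]
  rw [h3]
  refine h2.congr_fderiv ?_
  ext z
  simp [Finset.mul_sum, Finset.sum_mul]
  refine Finset.sum_congr rfl fun i _ => ?_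
  ring

theorem fderiv_single (y : Fin d → ℝ) (i : Fin d) :
    fderiv ℝ (stdGaussianDensity d) y (Pi.single i 1) = -(stdGaussianDensity d y * y i) := by
  rw [(hasFDerivAt y).fderiv]
  simp [Pi.single_apply]

theorem integrable_mul_apply (i : Fin d) :
    Integrable fun y : Fin d → ℝ => stdGaussianDensity d y * y i := by
  refine integrable_mul_norm.mono (continuous.mul (continuous_apply i)).aestronglyMeasurable
    (Filter.Eventually.of_forall fun y => ?_)
  rw [norm_mul, norm_mul, norm_norm]
  gcongr
  exact norm_le_pi_norm y i

theorem integral_mul_apply_mul {h : (Fin d → ℝ) → ℝ} {C D : ℝ} (hh : ContDiff ℝ 1 h)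
    (hC : ∀ z, |h z| ≤ C) (hD : ∀ z, ‖fderiv ℝ h z‖ ≤ D) (x : Fin d → ℝ) (σ : ℝ) (i : Fin d) :
    ∫ y, stdGaussianDensity d y * y i * h (x - σ • y)
      = -σ * ∫ y, stdGaussianDensity d y * fderiv ℝ h (x - σ • y) (Pi.single i 1) := by
  have hhc := hh.continuous
  have hhd : Continuous (fderiv ℝ h) := hh.continuous_fderiv one_ne_zero
  have hg (y : Fin d → ℝ) : HasFDerivAt (fun y => h (x - σ • y))
      ((fderiv ℝ h (x - σ • y)).comp (-(σ • ContinuousLinearMap.id ℝ (Fin d → ℝ)))) y := by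
    refine (hh.differentiable one_ne_zero _).hasFDerivAt.comp y ?_
    exact ((hasFDerivAt_id y).const_smul σ).const_sub x
  have hg' (y : Fin d → ℝ) : fderiv ℝ (fun y => h (x - σ • y)) y (Pi.single i 1)
      = -σ * fderiv ℝ h (x - σ • y) (Pi.single i 1) := by
    rw [(hg y).fderiv]; simp
  have hmeas : AEStronglyMeasurable (fun y => h (x - σ • y)) := by
    have : Continuous fun y => h (x - σ • y) := by fun_prop
    exact this.aestronglyMeasurable
  have hmeas' : AEStronglyMeasurable fun y => fderiv ℝ h (x - σ • y) (Pi.single i 1) := by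
    have : Continuous fun y => fderiv ℝ h (x - σ • y) (Pi.single i 1) := by fun_prop
    exact this.aestronglyMeasurable
  have key := integral_mul_fderiv_eq_neg_fderiv_mul_of_integrable (μ := volume)
    (f := stdGaussianDensity d) (g := fun y => h (x - σ • y)) (v := Pi.single i (1 : ℝ))
    ?_ ?_ ?_ (fun y _ => (hasFDerivAt y).differentiableAt) (fun y _ => (hg y).differentiableAt)
  · simp only [hg', fderiv_single, neg_mul, mul_neg, integral_neg, neg_neg] at key ⊢
    rw [← key, ← integral_const_mul]
    congr 2
    ext y
    ring
  · simp only [fderiv_single]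
    exact (integrable_mul_apply i).neg.mul_bdd (c := C) hmeas
      (Filter.Eventually.of_forall fun y => hC _)
  · simp only [hg']
    refine integrable.mul_bdd (c := |σ| * (D * ‖(Pi.single i 1 : Fin d → ℝ)‖)) (hmeas'.const_mul _)
      (Filter.Eventually.of_forall fun y => ?_)
    rw [norm_mul, norm_neg, Real.norm_eq_abs]
    gcongr
    exact ContinuousLinearMap.le_of_opNorm_le _ (hD _) _
  · exact integrable.mul_bdd (c := C) hmeas (Filter.Eventually.of_forall fun y => hC _)

theorem hasDerivAt_integral_update {h : (Fin d → ℝ) → ℝ} {C D : ℝ} (hh : ContDiff ℝ 1 h)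
    (hC : ∀ z, |h z| ≤ C) (hD : ∀ z, ‖fderiv ℝ h z‖ ≤ D) (x : Fin d → ℝ) (σ : ℝ) (i : Fin d)
    (s : ℝ) :
    HasDerivAt (fun r => ∫ y, stdGaussianDensity d y * h (Function.update x i r - σ • y))
      (∫ y, stdGaussianDensity d y *
        fderiv ℝ h (Function.update x i s - σ • y) (Pi.single i 1)) s := by
  obtain ⟨z, hz⟩ : ∃ z, ∀ r : ℝ, Function.update x i r = z + r • Pi.single i 1 := by
    refine ⟨Function.update x i 0, fun r => ?_⟩
    ext j
    by_cases hj : j = i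
    · subst hj; simp
    · simp [hj]
  simp only [hz, add_sub_right_comm]
  exact hasDerivAt_integral_mul_comp_add_smul continuous (by fun_prop) continuous_const hh hC hD
    integrable (integrable.mul_const _) s

theorem hasDerivAt_integral_scale {h : (Fin d → ℝ) → ℝ} {C D : ℝ} (hh : ContDiff ℝ 1 h)
    (hC : ∀ z, |h z| ≤ C) (hD : ∀ z, ‖fderiv ℝ h z‖ ≤ D) (x : Fin d → ℝ) (σ : ℝ) :
    HasDerivAt (fun r => ∫ y, stdGaussianDensity d y * h (x - r • y))
      (-∑ i, ∫ y, stdGaussianDensity d y * y i * fderiv ℝ h (x - σ • y) (Pi.single i 1)) σ := by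
  have hhd : Continuous (fderiv ℝ h) := hh.continuous_fderiv one_ne_zero
  have key := hasDerivAt_integral_mul_comp_add_smul (μ := volume) (p := fun _ => x)
    (q := fun y => -y) continuous continuous_const continuous_neg hh hC hD integrable
    (by simpa using integrable_mul_norm) σ
  simp only [smul_neg, ← sub_eq_add_neg, map_neg, mul_neg, integral_neg] at key
  refine key.congr_deriv (congrArg _ ?_)
  rw [← integral_finsetSum]
  · congr 1
    ext y
    have hL (L : (Fin d → ℝ) →L[ℝ] ℝ) : L y = ∑ i, y i * L (Pi.single i 1) := by
      conv_lhs => rw [pi_eq_sum_univ' y, map_sum]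
      simp only [map_smul, smul_eq_mul]
    rw [hL, Finset.mul_sum]
    simp only [mul_assoc]
  · intro i _
    have : Continuous fun y => fderiv ℝ h (x - σ • y) (Pi.single i 1) := by fun_prop
    exact (integrable_mul_apply i).mul_bdd (c := D * ‖(Pi.single i 1 : Fin d → ℝ)‖)
      this.aestronglyMeasurable (Filter.Eventually.of_forall fun y =>
        ContinuousLinearMap.le_of_opNorm_le _ (hD _) _)

end stdGaussianDensity

theorem norm_fderiv_fderiv_apply_le {E : Type*} [NormedAddCommGroup E] [NormedSpace ℝ E]
    {v : E → ℝ} (hv : ContDiff ℝ 2 v) {C : ℝ} (hC : ∀ x, ‖fderiv ℝ (fderiv ℝ v) x‖ ≤ C) (e z : E) :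
    ‖fderiv ℝ (fun y => fderiv ℝ v y e) z‖ ≤ C * ‖e‖ := by
  have hd : DifferentiableAt ℝ (fderiv ℝ v) z :=
    (hv.fderiv_right (m := 1) (by norm_num)).differentiable one_ne_zero z
  have hC0 : 0 ≤ C := (norm_nonneg (fderiv ℝ (fderiv ℝ v) z)).trans (hC z)
  refine ContinuousLinearMap.opNorm_le_bound _ (by positivity) fun y => ?_
  rw [fderiv_clm_apply hd (differentiableAt_const e)]
  simp only [fderiv_fun_const, Pi.zero_apply, ContinuousLinearMap.comp_zero, zero_add,
    ContinuousLinearMap.flip_apply]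
  calc ‖fderiv ℝ (fderiv ℝ v) z y e‖ ≤ ‖fderiv ℝ (fderiv ℝ v) z‖ * ‖y‖ * ‖e‖ :=
        ContinuousLinearMap.le_opNorm₂ _ _ _
    _ ≤ C * ‖y‖ * ‖e‖ := by gcongr; exact hC z
    _ = C * ‖e‖ * ‖y‖ := by ring

open MeasureTheory Real

theorem gaussian_smoothing_backward_heat (d : ℕ) (hd : 0 < d) (T : ℝ)
    (v : (Fin d → ℝ) → ℝ)
    (hv : ContDiff ℝ 2 v)
    (hvb : ∃ C : ℝ, ∀ x, |v x| ≤ C)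
    (hv1 : ∃ C : ℝ, ∀ x, ‖fderiv ℝ v x‖ ≤ C)
    (hv2 : ∃ C : ℝ, ∀ x, ‖fderiv ℝ (fderiv ℝ v) x‖ ≤ C)
    (w : (Fin d → ℝ) → ℝ → ℝ)
    (hw : w = fun (x : Fin d → ℝ) (t : ℝ) => ∫ y : Fin d → ℝ,
      (2 * π) ^ (-(d : ℝ) / 2) * Real.exp (-(∑ i, y i ^ 2) / 2)
        * v (x - Real.sqrt (2 * (T - t)) • y)) :
    ∀ (x : Fin d → ℝ), ∀ t < T,
      DifferentiableAt ℝ (w x) t ∧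
      (∀ i : Fin d,
        DifferentiableAt ℝ (fun s => w (Function.update x i s) t) (x i) ∧
        DifferentiableAt ℝ
          (fun s => deriv (fun s' => w (Function.update x i s') t) s) (x i)) ∧
      deriv (w x) t
        + ∑ i, deriv (fun s => deriv (fun s' => w (Function.update x i s') t) s) (x i) = 0 := by
  obtain ⟨C, hC⟩ := hvb
  obtain ⟨C₁, hC₁⟩ := hv1
  obtain ⟨C₂, hC₂⟩ := hv2
  intro x t ht
  have hw' (x : Fin d → ℝ) (t : ℝ) :
      w x t = ∫ y, stdGaussianDensity d y * v (x - Real.sqrt (2 * (T - t)) • y) := by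
    rw [hw]; rfl
  have hv' : ContDiff ℝ 1 v := hv.of_le (by norm_num)
  have hpos : 0 < 2 * (T - t) := by linarith
  set σ := Real.sqrt (2 * (T - t)) with hσ
  have hσ0 : σ ≠ 0 := (Real.sqrt_pos.2 hpos).ne'
  have hp (i : Fin d) : ContDiff ℝ 1 fun z => fderiv ℝ v z (Pi.single i 1) :=
    (hv.fderiv_right (m := 1) (by norm_num)).clm_apply contDiff_const
  have hpb (i : Fin d) (z : Fin d → ℝ) :
      |fderiv ℝ v z (Pi.single i 1)| ≤ C₁ * ‖(Pi.single i 1 : Fin d → ℝ)‖ :=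
    ContinuousLinearMap.le_of_opNorm_le _ (hC₁ z) _
  have hpd (i : Fin d) := norm_fderiv_fderiv_apply_le hv hC₂ (Pi.single i (1 : ℝ))
  have hx1 (i : Fin d) (s : ℝ) := stdGaussianDensity.hasDerivAt_integral_update hv' hC hC₁ x σ i s
  have hx2 (i : Fin d) :=
    stdGaussianDensity.hasDerivAt_integral_update (hp i) (hpb i) (hpd i) x σ i (x i)
  have hsqrt : HasDerivAt (fun r : ℝ => Real.sqrt (2 * (T - r))) (-1 / σ) t := by
    have := (((hasDerivAt_id t).const_sub T).const_mul 2).sqrt hpos.ne'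
    refine this.congr_deriv ?_
    change 2 * -1 / (2 * σ) = -1 / σ
    field_simp
  have ht1 := (stdGaussianDensity.hasDerivAt_integral_scale hv' hC hC₁ x σ).comp t hsqrt
  rw [show (fun r => ∫ y, stdGaussianDensity d y * v (x - r • y)) ∘
    (fun r : ℝ => Real.sqrt (2 * (T - r))) = w x from (funext (hw' x)).symm] at ht1
  simp only [hw', ← hσ, fun i s => (hx1 i s).deriv]
  refine ⟨ht1.differentiableAt, fun i => ⟨(hx1 i _).differentiableAt, (hx2 i).differentiableAt⟩, ?_⟩
  simp only [fun i => (hx2 i).deriv, Function.update_eq_self]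
  rw [ht1.deriv]
  simp only [fun i => stdGaussianDensity.integral_mul_apply_mul (hp i) (hpb i) (hpd i) x σ i,
    ← Finset.mul_sum]
  field_simp
  ring
end
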